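/- For n ≥ 3, ∑_{noc ∈ NOC_{a,1}(T_n)} w(noc) = C(n−2,2)·a·T_{n−2}(a,b) and ∑_{noc ∈ NOC_{1,b}(T_n)} w(noc) = C(n−2,2)·b·T_{n−2}(a,b). -/

import Mathlib

open Finset

/-- `D` is a Young-diagram-shaped finite set of cells (cell `(i,j)` is in row `i`, column `j`,
indexed from the top-left corner `(0,0)`). -/
def IsYoung (D : Finset (ℕ × ℕ)) : Prop :=
  ∀ i j i' j', (i, j) ∈ D → i' ≤ i → j' ≤ j → (i', j') ∈ D

/-- `(D, P)` is a tree-like tableau: `D` is the Young-diagram shape and `P ⊆ D` is the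
set of pointed cells.  The top-left cell is pointed (root point); every non-root
point has a point above it in its column or a point to its left in its row, but not both;
every row and every column of `D` contains a point. -/
def IsTLT (D P : Finset (ℕ × ℕ)) : Prop :=
  IsYoung D ∧ P ⊆ D ∧ (0, 0) ∈ P ∧
  (∀ c ∈ P, c ≠ (0, 0) →
    ((∃ r < c.1, (r, c.2) ∈ P) ↔ ¬ (∃ k < c.2, (c.1, k) ∈ P))) ∧
  (∀ c ∈ D, (∃ k, (c.1, k) ∈ P) ∧ (∃ r, (r, c.2) ∈ P))

/-- A corner of the diagram `D`: a cell whose bottom and right edges are border edges. -/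
def CornerCell (D : Finset (ℕ × ℕ)) (c : ℕ × ℕ) : Prop :=
  c ∈ D ∧ (c.1 + 1, c.2) ∉ D ∧ (c.1, c.2 + 1) ∉ D

open scoped Classical in
/-- The (finite) set of tree-like tableaux of size `n`; any such tableau has at most `n`
rows and `n` columns, hence fits inside the `(n+1) × (n+1)` grid. -/
noncomputable def TLTs (n : ℕ) : Finset (Finset (ℕ × ℕ) × Finset (ℕ × ℕ)) :=
  ((Finset.range (n + 1) ×ˢ Finset.range (n + 1)).powerset ×ˢ
      (Finset.range (n + 1) ×ˢ Finset.range (n + 1)).powerset).filter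
    (fun T => IsTLT T.1 T.2 ∧ T.2.card = n)


/-- Number of non-root points in the first row of the tableau `(D, P)`. -/
noncomputable def topStat (P : Finset (ℕ × ℕ)) : ℕ :=
  (P.filter (fun c => c.1 = 0 ∧ c ≠ (0, 0))).card

/-- Number of non-root points in the first column of the tableau `(D, P)`. -/
noncomputable def leftStat (P : Finset (ℕ × ℕ)) : ℕ :=
  (P.filter (fun c => c.2 = 0 ∧ c ≠ (0, 0))).card

/-- `c` is a non-occupied corner of `(D, P)` of type `(a,1)`: no point above it in its
column except in the first row, but some point to its left other than in the first
column. -/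
def NocA1 (D P : Finset (ℕ × ℕ)) (c : ℕ × ℕ) : Prop :=
  CornerCell D c ∧ c ∉ P ∧
  (∀ r, 0 < r → r < c.1 → (r, c.2) ∉ P) ∧
  (∃ k, 0 < k ∧ k < c.2 ∧ (c.1, k) ∈ P)

/-- `c` is a non-occupied corner of `(D, P)` of type `(1,b)`: no point to its left in
its row except in the first column, but some point above it other than in the first
row. -/
def Noc1B (D P : Finset (ℕ × ℕ)) (c : ℕ × ℕ) : Prop :=
  CornerCell D c ∧ c ∉ P ∧
  (∀ k, 0 < k → k < c.2 → (c.1, k) ∉ P) ∧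
  (∃ r, 0 < r ∧ r < c.1 ∧ (r, c.2) ∈ P)

section Aux
open scoped Classical

/-! ### Column deletion -/

def sg (j x : ℕ) : ℕ := if x < j then x else x + 1

lemma sg_inj (j : ℕ) : Function.Injective (sg j) := by
  intro x y h; unfold sg at h; split_ifs at h <;> omega

lemma sg_ne (j x : ℕ) : sg j x ≠ j := by unfold sg; split_ifs <;> omega

lemma sg_lt {j x y : ℕ} : sg j x < sg j y ↔ x < y := by
  unfold sg; split_ifs <;> omega

lemma sg_le {j x y : ℕ} : sg j x ≤ sg j y ↔ x ≤ y := by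
  unfold sg; split_ifs <;> omega

lemma sg_surj (j y : ℕ) : y = j ∨ ∃ y', y = sg j y' := by
  rcases lt_trichotomy y j with h | h | h
  · right; exact ⟨y, by simp [sg, h]⟩
  · left; exact h
  · right; refine ⟨y - 1, ?_⟩; unfold sg; split_ifs <;> omega

lemma sg_of_lt {j x : ℕ} (h : x < j) : sg j x = x := by simp [sg, h]

def sgc (j : ℕ) (c : ℕ × ℕ) : ℕ × ℕ := (c.1, sg j c.2)

lemma sgc_inj (j : ℕ) : Function.Injective (sgc j) := by
  rintro ⟨x, y⟩ ⟨x', y'⟩ h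
  simp only [sgc, Prod.mk.injEq] at h
  rw [h.1, sg_inj j h.2]

noncomputable def delcol (D : Finset (ℕ × ℕ)) (j : ℕ) : Finset (ℕ × ℕ) :=
  D.preimage (sgc j) (sgc_inj j).injOn

lemma mem_delcol {D : Finset (ℕ × ℕ)} {j x y : ℕ} :
    (x, y) ∈ delcol D j ↔ (x, sg j y) ∈ D := by
  simp [delcol, sgc]

noncomputable def ins (r j : ℕ) (P : Finset (ℕ × ℕ)) : Finset (ℕ × ℕ) :=
  insert (r, j) (P.image (sgc j))

lemma mem_ins_sg {P : Finset (ℕ × ℕ)} {r j x y : ℕ} :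
    (x, sg j y) ∈ ins r j P ↔ (x, y) ∈ P := by
  have h1 : ((x, sg j y) : ℕ × ℕ) = sgc j (x, y) := rfl
  unfold ins
  rw [mem_insert, h1, (sgc_inj j).mem_finset_image]
  constructor
  · rintro (h | h)
    · simp only [sgc, Prod.mk.injEq] at h
      exact absurd h.2 (sg_ne _ _)
    · exact h
  · exact Or.inr

lemma mem_ins_self {P : Finset (ℕ × ℕ)} {r j x : ℕ} :
    (x, j) ∈ ins r j P ↔ x = r := by
  unfold ins
  rw [mem_insert, mem_image]
  constructor
  · rintro (h | ⟨c, _, h⟩)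
    · exact (Prod.mk.inj h).1
    · exact absurd (Prod.mk.inj h).2 (sg_ne _ _)
  · rintro rfl; left; rfl

lemma delcol_ins (r j : ℕ) (P : Finset (ℕ × ℕ)) : delcol (ins r j P) j = P := by
  ext ⟨x, y⟩
  rw [mem_delcol, mem_ins_sg]

lemma ins_delcol {r j : ℕ} {P : Finset (ℕ × ℕ)} (h : ∀ x, (x, j) ∈ P ↔ x = r) :
    ins r j (delcol P j) = P := by
  ext ⟨x, y⟩
  rcases sg_surj j y with rfl | ⟨y', rfl⟩
  · rw [mem_ins_self, h]
  · rw [mem_ins_sg, mem_delcol]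

lemma young_delcol {D : Finset (ℕ × ℕ)} (h : IsYoung D) (j : ℕ) : IsYoung (delcol D j) := by
  intro i k i' k' hm hi hk
  rw [mem_delcol] at hm ⊢
  exact h _ _ _ _ hm hi (sg_le.2 hk)

lemma isTLT_delcol {D P : Finset (ℕ × ℕ)} {r j : ℕ} (hD : IsYoung D) (hj : 1 ≤ j)
    (hr : (r, j) ∈ D) (hP : ∀ x, (x, j) ∈ P ↔ x = r) (hk : ∃ k < j, (r, k) ∈ P) :
    IsTLT D P ↔ IsTLT (delcol D j) (delcol P j) := by
  obtain ⟨k0, hk0, hk0P⟩ := hk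
  have h0 : sg j 0 = 0 := sg_of_lt hj
  constructor
  · rintro ⟨-, hsub, hroot, hx, hc⟩
    refine ⟨young_delcol hD j, ?_, ?_, ?_, ?_⟩
    · rintro ⟨x, y⟩ h
      rw [mem_delcol] at h ⊢
      exact hsub h
    · rw [mem_delcol, h0]; exact hroot
    · rintro ⟨x, y⟩ h hne
      rw [mem_delcol] at h
      have hne' : (x, sg j y) ≠ (0, 0) := by
        intro h'
        have h1 := Prod.mk.inj h'
        apply hne
        rw [h1.1]
        have : sg j y = sg j 0 := by rw [h0]; exact h1.2
        rw [sg_inj j this]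
      have := hx _ h hne'
      simp only [mem_delcol]
      simp only at this
      rw [this]
      apply not_congr
      constructor
      · rintro ⟨k, hk, hkP⟩
        rcases sg_surj j k with rfl | ⟨k', rfl⟩
        · rw [hP] at hkP
          subst hkP
          refine ⟨k0, ?_, ?_⟩
          · rw [← sg_of_lt hk0] at hk0
            exact sg_lt.1 (hk0.trans hk)
          · rw [sg_of_lt hk0]; exact hk0P
        · exact ⟨k', sg_lt.1 hk, hkP⟩
      · rintro ⟨k, hk, hkP⟩
        exact ⟨sg j k, sg_lt.2 hk, hkP⟩
    · rintro ⟨x, y⟩ h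
      rw [mem_delcol] at h
      obtain ⟨⟨k, hkP⟩, ⟨s, hs⟩⟩ := hc _ h
      simp only at hkP hs
      refine ⟨?_, ⟨s, mem_delcol.2 hs⟩⟩
      rcases sg_surj j k with rfl | ⟨k', rfl⟩
      · rw [hP] at hkP
        subst hkP
        refine ⟨k0, ?_⟩
        rw [mem_delcol, sg_of_lt hk0]; exact hk0P
      · exact ⟨k', mem_delcol.2 hkP⟩
  · rintro ⟨-, hsub, hroot, hx, hc⟩
    refine ⟨hD, ?_, ?_, ?_, ?_⟩
    · rintro ⟨x, y⟩ h
      rcases sg_surj j y with rfl | ⟨y', rfl⟩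
      · rw [hP] at h; subst h; exact hr
      · exact mem_delcol.1 (hsub (mem_delcol.2 h))
    · rw [mem_delcol, h0] at hroot; exact hroot
    · rintro ⟨x, y⟩ h hne
      simp only
      rcases sg_surj j y with rfl | ⟨y', rfl⟩
      · rw [hP] at h; subst h
        constructor
        · rintro ⟨s, hs, hsP⟩
          rw [hP] at hsP; omega
        · intro h'; exact absurd ⟨k0, hk0, hk0P⟩ h'
      · have hne' : (x, y') ≠ (0, 0) := by
          intro h'
          have h1 := Prod.mk.inj h'
          apply hne
          rw [h1.1, h1.2, h0]
        have := hx _ (mem_delcol.2 h) hne'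
        simp only [mem_delcol] at this
        rw [this]
        apply not_congr
        constructor
        · rintro ⟨k, hk, hkP⟩
          exact ⟨sg j k, sg_lt.2 hk, hkP⟩
        · rintro ⟨k, hk, hkP⟩
          rcases sg_surj j k with rfl | ⟨k', rfl⟩
          · rw [hP] at hkP
            subst hkP
            refine ⟨k0, ?_, ?_⟩
            · rw [← sg_of_lt hk0] at hk0
              exact sg_lt.1 (hk0.trans hk)
            · rw [sg_of_lt hk0]; exact hk0P
          · exact ⟨k', sg_lt.1 hk, hkP⟩
    · rintro ⟨x, y⟩ h
      constructor
      · have h1 : (x, 0) ∈ delcol D j := by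
          rw [mem_delcol, h0]; exact hD _ _ _ _ h le_rfl (Nat.zero_le _)
        obtain ⟨⟨k, hkP⟩, -⟩ := hc _ h1
        exact ⟨_, mem_delcol.1 hkP⟩
      · rcases sg_surj j y with rfl | ⟨y', rfl⟩
        · exact ⟨r, (hP r).2 rfl⟩
        · obtain ⟨-, ⟨s, hs⟩⟩ := hc _ (mem_delcol.2 h)
          exact ⟨s, mem_delcol.1 hs⟩

noncomputable def TL (D : Finset (ℕ × ℕ)) : Finset (Finset (ℕ × ℕ)) :=
  D.powerset.filter (fun P => IsTLT D P)

lemma mem_TL {D P : Finset (ℕ × ℕ)} : P ∈ TL D ↔ IsTLT D P := by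
  unfold TL
  rw [mem_filter, mem_powerset]
  exact ⟨fun h => h.2, fun h => ⟨h.2.1, h⟩⟩

lemma col_sum {D : Finset (ℕ × ℕ)} {r j : ℕ} (hD : IsYoung D) (hj : 1 ≤ j)
    (hr : (r, j) ∈ D) (f : Finset (ℕ × ℕ) → ℚ) :
    ∑ P ∈ (TL D).filter (fun P => (∀ x, (x, j) ∈ P ↔ x = r) ∧ ∃ k < j, (r, k) ∈ P), f P
    = ∑ P ∈ (TL (delcol D j)).filter (fun P => ∃ k < j, (r, k) ∈ P), f (ins r j P) := by
  refine Finset.sum_bij' (fun P _ => delcol P j) (fun P _ => ins r j P) ?_ ?_ ?_ ?_ ?_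
  · intro P h
    rw [mem_filter, mem_TL] at h ⊢
    refine ⟨(isTLT_delcol hD hj hr h.2.1 h.2.2).1 h.1, ?_⟩
    obtain ⟨k, hk, hkP⟩ := h.2.2
    exact ⟨k, hk, by rw [mem_delcol, sg_of_lt hk]; exact hkP⟩
  · intro P h
    rw [mem_filter, mem_TL] at h ⊢
    have h2 : ∃ k < j, (r, k) ∈ ins r j P := by
      obtain ⟨k, hk, hkP⟩ := h.2
      refine ⟨k, hk, ?_⟩
      rw [← sg_of_lt hk, mem_ins_sg]; exact hkP
    refine ⟨?_, fun x => mem_ins_self, h2⟩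
    rw [isTLT_delcol hD hj hr (fun x => mem_ins_self) h2, delcol_ins]
    exact h.1
  · intro P h
    rw [mem_filter] at h
    exact ins_delcol h.2.1
  · intro P h
    exact delcol_ins _ _ _
  · intro P h
    rw [mem_filter] at h
    rw [ins_delcol h.2.1]

/-! ### Transposition -/

def sw (D : Finset (ℕ × ℕ)) : Finset (ℕ × ℕ) := D.image Prod.swap

lemma mem_sw {D : Finset (ℕ × ℕ)} {x y : ℕ} : (x, y) ∈ sw D ↔ (y, x) ∈ D := by
  have : ((x, y) : ℕ × ℕ) = Prod.swap (y, x) := rfl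
  unfold sw
  rw [this, Prod.swap_injective.mem_finset_image]

lemma sw_sw (D : Finset (ℕ × ℕ)) : sw (sw D) = D := by
  ext ⟨x, y⟩; rw [mem_sw, mem_sw]

lemma young_sw {D : Finset (ℕ × ℕ)} (h : IsYoung D) : IsYoung (sw D) := by
  intro i j i' j' hm hi hj
  rw [mem_sw] at hm ⊢
  exact h _ _ _ _ hm hj hi

lemma isTLT_sw {D P : Finset (ℕ × ℕ)} (h : IsTLT D P) : IsTLT (sw D) (sw P) := by
  obtain ⟨h1, h2, h3, h4, h5⟩ := h
  refine ⟨young_sw h1, ?_, ?_, ?_, ?_⟩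
  · rintro ⟨x, y⟩ h
    rw [mem_sw] at h ⊢
    exact h2 h
  · rw [mem_sw]; exact h3
  · rintro ⟨x, y⟩ h hne
    rw [mem_sw] at h
    have := h4 _ h (by intro h'; apply hne; rw [Prod.mk.injEq] at h' ⊢; exact h'.symm)
    simp only [mem_sw] at this ⊢
    exact ⟨fun h1 h2 => (this.1 h2) h1, fun h1 => by_contra fun h2 => h1 (this.2 h2)⟩
  · rintro ⟨x, y⟩ h
    rw [mem_sw] at h
    have := h5 _ h
    simp only [mem_sw] at this ⊢
    exact ⟨this.2, this.1⟩

lemma isTLT_sw_iff {D P : Finset (ℕ × ℕ)} : IsTLT (sw D) (sw P) ↔ IsTLT D P := by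
  refine ⟨fun h => ?_, isTLT_sw⟩
  have := isTLT_sw h
  rwa [sw_sw, sw_sw] at this

lemma card_sw (D : Finset (ℕ × ℕ)) : (sw D).card = D.card :=
  card_image_of_injective _ Prod.swap_injective

lemma top_sw (P : Finset (ℕ × ℕ)) : topStat (sw P) = leftStat P := by
  unfold topStat leftStat
  rw [← card_sw (P.filter _)]
  congr 1
  ext ⟨x, y⟩
  simp only [mem_filter, mem_sw, ne_eq, Prod.mk.injEq]
  tauto

lemma left_sw (P : Finset (ℕ × ℕ)) : leftStat (sw P) = topStat P := by
  rw [← top_sw, sw_sw]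

noncomputable def delrow (D : Finset (ℕ × ℕ)) (i : ℕ) : Finset (ℕ × ℕ) := sw (delcol (sw D) i)

lemma mem_delrow {D : Finset (ℕ × ℕ)} {i x y : ℕ} :
    (x, y) ∈ delrow D i ↔ (sg i x, y) ∈ D := by
  unfold delrow
  rw [mem_sw, mem_delcol, mem_sw]

lemma row_sum {D : Finset (ℕ × ℕ)} {i s : ℕ} (hD : IsYoung D) (hi : 1 ≤ i)
    (hs : (i, s) ∈ D) (f : Finset (ℕ × ℕ) → ℚ) :
    ∑ P ∈ (TL D).filter (fun P => (∀ y, (i, y) ∈ P ↔ y = s) ∧ ∃ k < i, (k, s) ∈ P), f P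
    = ∑ P ∈ (TL (delrow D i)).filter (fun P => ∃ k < i, (k, s) ∈ P), f (sw (ins s i (sw P))) := by
  have key := col_sum (young_sw hD) hi (mem_sw.2 hs) (fun P => f (sw P))
  refine Eq.trans ?_ (key.trans ?_)
  · refine Finset.sum_bij' (fun P _ => sw P) (fun P _ => sw P) ?_ ?_ ?_ ?_ ?_
    · intro P h
      simp only [mem_filter, mem_TL, mem_sw] at h ⊢
      exact ⟨isTLT_sw h.1, h.2⟩
    · intro P h
      simp only [mem_filter, mem_TL, mem_sw] at h ⊢
      refine ⟨?_, h.2⟩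
      have := isTLT_sw h.1
      rwa [sw_sw] at this
    · intro P _; exact sw_sw P
    · intro P _; exact sw_sw P
    · intro P _; simp only [sw_sw]
  · refine Finset.sum_bij' (fun P _ => sw P) (fun P _ => sw P) ?_ ?_ ?_ ?_ ?_
    · intro P h
      simp only [mem_filter, mem_TL, mem_sw] at h ⊢
      exact ⟨isTLT_sw h.1, h.2⟩
    · intro P h
      simp only [mem_filter, mem_TL, mem_sw] at h ⊢
      refine ⟨?_, h.2⟩
      have := isTLT_sw h.1
      rwa [delrow, sw_sw] at this
    · intro P _; exact sw_sw P
    · intro P _; exact sw_sw P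
    · intro P _; simp only [sw_sw]

/-! ### Weights -/

noncomputable def wt (a b : ℚ) (P : Finset (ℕ × ℕ)) : ℚ := a ^ topStat P * b ^ leftStat P

lemma wt_sw (a b : ℚ) (P : Finset (ℕ × ℕ)) : wt a b (sw P) = wt b a P := by
  unfold wt; rw [top_sw, left_sw, mul_comm]

lemma left_ins {r j : ℕ} (hj : 1 ≤ j) (P : Finset (ℕ × ℕ)) :
    leftStat (ins r j P) = leftStat P := by
  unfold leftStat
  congr 1
  ext ⟨x, y⟩
  have h0 : sg j 0 = 0 := sg_of_lt hj
  simp only [mem_filter, ne_eq, Prod.mk.injEq]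
  constructor
  · rintro ⟨h, rfl, h'⟩
    rw [← h0, mem_ins_sg] at h
    exact ⟨h, rfl, h'⟩
  · rintro ⟨h, rfl, h'⟩
    refine ⟨?_, rfl, h'⟩
    rw [← h0, mem_ins_sg]; exact h

lemma top_image {j : ℕ} (hj : 1 ≤ j) (P : Finset (ℕ × ℕ)) :
    (((P.image (sgc j)).filter (fun c => c.1 = 0 ∧ c ≠ (0, 0)))).card = topStat P := by
  have h0 : sg j 0 = 0 := sg_of_lt hj
  have hs : ∀ c : ℕ × ℕ, sgc j c = (0, 0) ↔ c = (0, 0) := by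
    intro c
    have h1 : ((0, 0) : ℕ × ℕ) = sgc j (0, 0) := by simp [sgc, h0]
    constructor
    · intro h; rw [h1] at h; exact sgc_inj j h
    · rintro rfl; exact h1.symm
  rw [Finset.filter_image, card_image_of_injective _ (sgc_inj j)]
  unfold topStat
  congr 1
  ext c
  simp only [mem_filter, ne_eq, hs]
  rfl

lemma top_ins_pos {r j : ℕ} (hj : 1 ≤ j) (hr : r ≠ 0) (P : Finset (ℕ × ℕ)) :
    topStat (ins r j P) = topStat P := by
  rw [← top_image hj P]
  unfold topStat ins
  rw [filter_insert, if_neg (by simp [hr])]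

lemma top_ins_zero {j : ℕ} (hj : 1 ≤ j) (P : Finset (ℕ × ℕ)) :
    topStat (ins 0 j P) = topStat P + 1 := by
  rw [← top_image hj P]
  unfold topStat ins
  rw [filter_insert, if_pos (by simp; omega), card_insert_of_notMem]
  rw [mem_filter, mem_image]
  rintro ⟨⟨c, _, h⟩, _⟩
  exact sg_ne _ _ (Prod.mk.inj h).2

lemma wt_ins_pos (a b : ℚ) {r j : ℕ} (hj : 1 ≤ j) (hr : r ≠ 0) (P : Finset (ℕ × ℕ)) :
    wt a b (ins r j P) = wt a b P := by
  unfold wt; rw [left_ins hj, top_ins_pos hj hr]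

lemma wt_ins_zero (a b : ℚ) {j : ℕ} (hj : 1 ≤ j) (P : Finset (ℕ × ℕ)) :
    wt a b (ins 0 j P) = a * wt a b P := by
  unfold wt; rw [left_ins hj, top_ins_zero hj]; ring

noncomputable def W (a b : ℚ) (D : Finset (ℕ × ℕ)) : ℚ := ∑ P ∈ TL D, wt a b P

/-- Column with only the top point. -/
lemma col_top (a b : ℚ) {D : Finset (ℕ × ℕ)} {j : ℕ} (hD : IsYoung D) (hj : 1 ≤ j)
    (hr : (0, j) ∈ D) (q : Finset (ℕ × ℕ) → Prop) :
    ∑ P ∈ (TL D).filter (fun P => (∀ x, 0 < x → (x, j) ∉ P) ∧ q P), wt a b P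
    = a * ∑ P ∈ (TL (delcol D j)).filter (fun P => q (ins 0 j P)), wt a b P := by
  have key := col_sum hD hj hr (fun P => if q P then wt a b P else 0)
  rw [← Finset.sum_filter, ← Finset.sum_filter, filter_filter, filter_filter] at key
  rw [mul_sum]
  refine Eq.trans (Finset.sum_congr ?_ fun _ _ => rfl) (key.trans (Finset.sum_congr ?_ ?_))
  · ext P
    simp only [mem_filter, mem_TL]
    constructor
    · rintro ⟨h, h1, h2⟩
      refine ⟨h, ⟨fun x => ⟨fun hx => ?_, ?_⟩, 0, hj, h.2.2.1⟩, h2⟩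
      · by_contra hne; exact h1 x (Nat.pos_of_ne_zero hne) hx
      · rintro rfl
        obtain ⟨-, s, hs⟩ := h.2.2.2.2 _ hr
        simp only at hs
        rcases Nat.eq_zero_or_pos s with rfl | hp
        · exact hs
        · exact absurd hs (h1 s hp)
    · rintro ⟨h, ⟨h1, -⟩, h2⟩
      refine ⟨h, fun x hx hxP => ?_, h2⟩
      rw [h1] at hxP; omega
  · ext P
    simp only [mem_filter, mem_TL]
    constructor
    · rintro ⟨h, h1, h2⟩; exact ⟨h, h2⟩
    · rintro ⟨h, h2⟩; exact ⟨h, ⟨0, hj, h.2.2.1⟩, h2⟩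
  · intro P _
    rw [wt_ins_zero _ _ hj]

/-- Row with only the left point. -/
lemma row_left (a b : ℚ) {D : Finset (ℕ × ℕ)} {i : ℕ} (hD : IsYoung D) (hi : 1 ≤ i)
    (hr : (i, 0) ∈ D) :
    ∑ P ∈ (TL D).filter (fun P => (∀ y, 0 < y → (i, y) ∉ P)), wt a b P
    = b * W a b (delrow D i) := by
  have key := row_sum hD hi hr (fun P => wt a b P)
  unfold W
  rw [mul_sum]
  refine Eq.trans (Finset.sum_congr ?_ fun _ _ => rfl) (key.trans (Finset.sum_congr ?_ ?_))
  · ext P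
    simp only [mem_filter, mem_TL]
    constructor
    · rintro ⟨h, h1⟩
      refine ⟨h, ⟨fun x => ⟨fun hx => ?_, ?_⟩, 0, hi, h.2.2.1⟩⟩
      · by_contra hne; exact h1 x (Nat.pos_of_ne_zero hne) hx
      · rintro rfl
        obtain ⟨⟨s, hs⟩, -⟩ := h.2.2.2.2 _ hr
        simp only at hs
        rcases Nat.eq_zero_or_pos s with rfl | hp
        · exact hs
        · exact absurd hs (h1 s hp)
    · rintro ⟨h, ⟨h1, -⟩⟩
      refine ⟨h, fun x hx hxP => ?_⟩
      rw [h1] at hxP; omega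
  · ext P
    simp only [mem_filter, mem_TL]
    constructor
    · rintro ⟨h, h1⟩; exact h
    · intro h; exact ⟨h, ⟨0, hi, h.2.2.1⟩⟩
  · intro P _
    rw [wt_sw, wt_ins_zero _ _ hi, wt_sw]

lemma young_erase {D : Finset (ℕ × ℕ)} (hD : IsYoung D) {i j : ℕ} (hc : CornerCell D (i, j)) :
    IsYoung (D.erase (i, j)) := by
  obtain ⟨h1, h2, h3⟩ := hc
  simp only at h2 h3
  intro x y x' y' h hx hy
  rw [mem_erase] at h ⊢
  refine ⟨?_, hD _ _ _ _ h.2 hx hy⟩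
  intro he
  obtain ⟨rfl, rfl⟩ := Prod.mk.inj he
  rcases Nat.lt_or_ge x' x with hlt | hge
  · exact h2 (hD _ _ _ _ h.2 hlt hy)
  · rcases Nat.lt_or_ge y' y with hlt | hge'
    · exact h3 (hD _ _ _ _ h.2 hx hlt)
    · apply h.1; rw [Prod.mk.injEq]; omega

lemma corner_rec (a b : ℚ) {D : Finset (ℕ × ℕ)} {i j : ℕ} (hD : IsYoung D)
    (hi : 1 ≤ i) (hj : 1 ≤ j) (hc : CornerCell D (i, j)) :
    W a b D = W a b (D.erase (i, j)) + W a b (delcol D j) + W a b (delrow D i) := by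
  have hcc := hc
  obtain ⟨h1, h2, h3⟩ := hc
  simp only at h2 h3
  have below : ∀ x y, (x, y) ∈ D → y = j → x ≤ i := by
    rintro x y h rfl
    by_contra hlt
    exact h2 (hD _ _ _ _ h (by omega) le_rfl)
  have right : ∀ x y, (x, y) ∈ D → x = i → y ≤ j := by
    rintro x y h rfl
    by_contra hlt
    exact h3 (hD _ _ _ _ h le_rfl (by omega))
  have e1 : W a b D = ∑ P ∈ (TL D).filter (fun P => (i, j) ∉ P), wt a b P
      + ∑ P ∈ (TL D).filter (fun P => (i, j) ∈ P ∧ ∃ k < j, (i, k) ∈ P), wt a b P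
      + ∑ P ∈ (TL D).filter (fun P => (i, j) ∈ P ∧ ¬ ∃ k < j, (i, k) ∈ P), wt a b P := by
    unfold W
    rw [← Finset.sum_filter_add_sum_filter_not (TL D) (fun P => (i, j) ∈ P),
      ← Finset.sum_filter_add_sum_filter_not ((TL D).filter (fun P => (i, j) ∈ P))
        (fun P => ∃ k < j, (i, k) ∈ P), filter_filter, filter_filter]
    ring
  rw [e1]
  congr 1
  · congr 1
    · unfold W
      refine Finset.sum_congr ?_ fun _ _ => rfl
      ext P
      simp only [mem_filter, mem_TL]
      constructor
      · rintro ⟨⟨g1, g2, g3, g4, g5⟩, g⟩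
        refine ⟨young_erase hD hcc, ?_, g3, g4, fun c hc => g5 c (mem_of_mem_erase hc)⟩
        intro c hc
        rw [mem_erase]
        exact ⟨fun h => g (h ▸ hc), g2 hc⟩
      · rintro ⟨g1, g2, g3, g4, g5⟩
        refine ⟨⟨hD, fun c hc => mem_of_mem_erase (g2 hc), g3, g4, ?_⟩,
          fun h => (mem_erase.1 (g2 h)).1 rfl⟩
        intro c hc
        by_cases h : c = (i, j)
        · subst h
          have ha : (i, 0) ∈ D.erase (i, j) := by
            rw [mem_erase]
            refine ⟨?_, hD _ _ _ _ h1 le_rfl (Nat.zero_le _)⟩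
            rw [ne_eq, Prod.mk.injEq]; omega
          have hb : (0, j) ∈ D.erase (i, j) := by
            rw [mem_erase]
            refine ⟨?_, hD _ _ _ _ h1 (Nat.zero_le _) le_rfl⟩
            rw [ne_eq, Prod.mk.injEq]; omega
          exact ⟨(g5 _ ha).1, (g5 _ hb).2⟩
        · exact g5 c (mem_erase.2 ⟨h, hc⟩)
    · have key := col_sum hD hj h1 (fun P => wt a b P)
      refine Eq.trans (Finset.sum_congr ?_ fun _ _ => rfl) (key.trans (Finset.sum_congr ?_ ?_))
      · ext P
        simp only [mem_filter, mem_TL]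
        constructor
        · rintro ⟨h, hp, hk⟩
          refine ⟨h, fun x => ⟨fun hx => ?_, ?_⟩, hk⟩
          · have h4 := (h.2.2.2.1 _ hp (by rw [ne_eq, Prod.mk.injEq]; omega)).not.2 (not_not.2 hk)
            have := below x j (h.2.1 hx) rfl
            by_contra hne
            exact h4 ⟨x, by simp only; omega, hx⟩
          · rintro rfl; exact hp
        · rintro ⟨h, hp, hk⟩
          exact ⟨h, (hp i).2 rfl, hk⟩
      · ext P
        simp only [mem_filter, mem_TL]
        constructor
        · rintro ⟨h, h1⟩; exact h
        · intro h
          refine ⟨h, ?_⟩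
          have h0 : (i, 0) ∈ delcol D j := by
            rw [mem_delcol, sg_of_lt hj]; exact hD _ _ _ _ h1 le_rfl (Nat.zero_le _)
          obtain ⟨⟨k, hk⟩, -⟩ := h.2.2.2.2 _ h0
          refine ⟨k, ?_, hk⟩
          have h5 := right _ _ (mem_delcol.1 (h.2.1 hk)) rfl
          by_contra hlt
          unfold sg at h5
          split_ifs at h5 <;> omega
      · intro P _
        rw [wt_ins_pos _ _ hj (by omega)]
  · have key := row_sum hD hi h1 (fun P => wt a b P)
    refine Eq.trans (Finset.sum_congr ?_ fun _ _ => rfl) (key.trans (Finset.sum_congr ?_ ?_))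
    · ext P
      simp only [mem_filter, mem_TL]
      constructor
      · rintro ⟨h, hp, hk⟩
        refine ⟨h, fun x => ⟨fun hx => ?_, ?_⟩, ?_⟩
        · have := right i x (h.2.1 hx) rfl
          by_contra hne
          exact hk ⟨x, by omega, hx⟩
        · rintro rfl; exact hp
        · exact (h.2.2.2.1 _ hp (by rw [ne_eq, Prod.mk.injEq]; omega)).2 hk
      · rintro ⟨h, hp, hk⟩
        have hp' := (hp j).2 rfl
        exact ⟨h, hp', (h.2.2.2.1 _ hp' (by rw [ne_eq, Prod.mk.injEq]; omega)).1 hk⟩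
    · ext P
      simp only [mem_filter, mem_TL]
      constructor
      · rintro ⟨h, h1⟩; exact h
      · intro h
        refine ⟨h, ?_⟩
        have h0 : (0, j) ∈ delrow D i := by
          rw [mem_delrow, sg_of_lt hi]; exact hD _ _ _ _ h1 (Nat.zero_le _) le_rfl
        obtain ⟨-, ⟨k, hk⟩⟩ := h.2.2.2.2 _ h0
        refine ⟨k, ?_, hk⟩
        have h5 := below _ _ (mem_delrow.1 (h.2.1 hk)) rfl
        by_contra hlt
        unfold sg at h5
        split_ifs at h5 <;> omega
    · intro P _
      rw [wt_sw, wt_ins_pos _ _ hi (by omega), wt_sw]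

/-! ### Words and shapes -/

def shape : List Bool → Finset (ℕ × ℕ)
  | [] => {(0, 0)}
  | false :: w => (shape w).image (fun c => (c.1, c.2 + 1)) ∪ (shape w).filter (fun c => c.2 = 0)
  | true :: w => insert (w.count true + 1, 0) (shape w)

lemma mem_nil {i j : ℕ} : (i, j) ∈ shape [] ↔ i = 0 ∧ j = 0 := by
  simp [shape]

lemma mem_false {w : List Bool} {i j : ℕ} :
    (i, j) ∈ shape (false :: w) ↔ (i, j - 1) ∈ shape w := by
  simp only [shape, mem_union, mem_image, mem_filter, Prod.mk.injEq, Prod.exists]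
  constructor
  · rintro (⟨x, y, h, rfl, rfl⟩ | ⟨h, rfl⟩)
    · simpa using h
    · exact h
  · intro h
    rcases Nat.eq_zero_or_pos j with rfl | hj
    · right; exact ⟨h, rfl⟩
    · left; exact ⟨i, j - 1, h, rfl, by omega⟩

lemma mem_true {w : List Bool} {i j : ℕ} :
    (i, j) ∈ shape (true :: w) ↔ (i = w.count true + 1 ∧ j = 0) ∨ (i, j) ∈ shape w := by
  simp [shape]

lemma mem_col0 {w : List Bool} {i : ℕ} : (i, 0) ∈ shape w ↔ i ≤ w.count true := by
  induction w with
  | nil => rw [mem_nil]; simp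
  | cons x w ih =>
    cases x
    · rw [mem_false, ih]; simp
    · rw [mem_true, ih]; simp; omega

lemma mem_row0 {w : List Bool} {j : ℕ} : (0, j) ∈ shape w ↔ j ≤ w.count false := by
  induction w generalizing j with
  | nil => rw [mem_nil]; simp
  | cons x w ih =>
    cases x
    · rw [mem_false, ih]; simp
    · rw [mem_true, ih]; simp

lemma row_le {w : List Bool} {i j : ℕ} (h : (i, j) ∈ shape w) : i ≤ w.count true := by
  induction w generalizing j with
  | nil => rw [mem_nil] at h; simp [h.1]
  | cons x w ih =>
    cases x
    · rw [mem_false] at h; simpa using ih h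
    · rw [mem_true] at h
      simp only [List.count_cons_self]
      rcases h with h | h
      · omega
      · have := ih h; omega

lemma young_shape (w : List Bool) : IsYoung (shape w) := by
  induction w with
  | nil =>
    intro i j i' j' h hi hj
    rw [mem_nil] at h ⊢; omega
  | cons x w ih =>
    intro i j i' j' h hi hj
    cases x
    · rw [mem_false] at h ⊢
      exact ih _ _ _ _ h hi (by omega)
    · rw [mem_true] at h ⊢
      rcases h with h | h
      · by_cases hh : i' = w.count true + 1
        · left; omega
        · right
          have : j' = 0 := by omega
          subst this
          rw [mem_col0]; omega
      · right; exact ih _ _ _ _ h hi hj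

lemma col_le {w : List Bool} {i j : ℕ} (h : (i, j) ∈ shape w) : j ≤ w.count false :=
  mem_row0.1 (young_shape w _ _ _ _ h (Nat.zero_le _) le_rfl)

lemma mem_row {u v : List Bool} {j : ℕ} :
    (v.count true + 1, j) ∈ shape (u ++ true :: v) ↔ j ≤ u.count false := by
  induction u generalizing j with
  | nil =>
    simp only [List.nil_append, mem_true, List.count_nil]
    constructor
    · rintro (h | h)
      · omega
      · have := row_le h; omega
    · intro h; left; exact ⟨trivial, Nat.le_zero.1 h⟩
  | cons x u ih =>
    cases x
    · rw [List.cons_append, mem_false, ih]; simp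
    · rw [List.cons_append, mem_true, ih]; simp; intros; omega

lemma mem_col {u v : List Bool} {i : ℕ} :
    (i, u.count false + 1) ∈ shape (u ++ false :: v) ↔ i ≤ v.count true := by
  induction u with
  | nil =>
    simp only [List.nil_append, mem_false, List.count_nil]
    exact mem_col0
  | cons x u ih =>
    cases x
    · rw [List.cons_append, mem_false, ← ih]; simp
    · rw [List.cons_append, mem_true, ← ih]; simp

lemma delcol_shape (u v : List Bool) :
    delcol (shape (u ++ false :: v)) (u.count false + 1) = shape (u ++ v) := by
  ext ⟨i, j⟩
  rw [mem_delcol]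
  induction u generalizing j with
  | nil =>
    simp only [List.nil_append, mem_false, List.count_nil]
    have : sg (0 + 1) j - 1 = j := by unfold sg; split_ifs <;> omega
    rw [this]
  | cons x u ih =>
    cases x
    · rw [List.cons_append, List.cons_append, mem_false, mem_false, ← ih, List.count_cons_self]
      have : sg (u.count false + 1 + 1) j - 1 = sg (u.count false + 1) (j - 1) := by
        unfold sg; split_ifs <;> omega
      rw [this]
    · rw [List.cons_append, List.cons_append, mem_true, mem_true, ← ih]
      have h1 : (u ++ false :: v).count true = (u ++ v).count true := by simp
      have h2 : (true :: u).count false = u.count false := by simp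
      rw [h1, h2]
      have h3 : sg (u.count false + 1) j = 0 ↔ j = 0 := by
        constructor
        · intro h
          unfold sg at h
          split_ifs at h
          exact h
        · rintro rfl
          exact sg_of_lt (by omega)
      rw [h3]

lemma delrow_shape (u v : List Bool) :
    delrow (shape (u ++ true :: v)) (v.count true + 1) = shape (u ++ v) := by
  ext ⟨i, j⟩
  rw [mem_delrow]
  induction u generalizing j with
  | nil =>
    simp only [List.nil_append, mem_true]
    unfold sg
    split_ifs with h
    · constructor
      · rintro (h' | h')
        · omega
        · exact h'
      · exact Or.inr
    · constructor
      · rintro (h' | h')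
        · omega
        · have := row_le h'; omega
      · intro h'; have := row_le h'; omega
  | cons x u ih =>
    cases x
    · rw [List.cons_append, List.cons_append, mem_false, mem_false, ← ih]
    · rw [List.cons_append, List.cons_append, mem_true, mem_true, ← ih]
      have h1 : (u ++ true :: v).count true = (u ++ v).count true + 1 := by
        simp; omega
      have h2 : v.count true ≤ (u ++ v).count true := by simp
      rw [h1]
      have h3 : sg (v.count true + 1) i = (u ++ v).count true + 1 + 1
          ↔ i = (u ++ v).count true + 1 := by
        unfold sg; split_ifs <;> omega
      rw [h3]

lemma corner_shape (u v : List Bool) :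
    CornerCell (shape (u ++ false :: true :: v)) (v.count true + 1, u.count false + 1) := by
  have h1 : u ++ false :: true :: v = (u ++ [false]) ++ true :: v := by simp
  refine ⟨?_, ?_, ?_⟩
  · rw [mem_col]; simp
  · simp only; rw [mem_col]; simp
  · simp only; rw [h1, mem_row]; simp

lemma erase_shape (u v : List Bool) :
    (shape (u ++ false :: true :: v)).erase (v.count true + 1, u.count false + 1)
      = shape (u ++ true :: false :: v) := by
  have key : ∀ i j, (i, j) ∈ shape (u ++ false :: true :: v) ↔
      ((i = v.count true + 1 ∧ j = u.count false + 1) ∨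
        (i, j) ∈ shape (u ++ true :: false :: v)) := by
    intro i j
    induction u generalizing j with
    | nil =>
      simp only [List.nil_append, mem_false, mem_true, List.count_nil]
      have : (false :: v).count true = v.count true := by simp
      rw [this]
      rcases j with _ | _ | j
      · simp
      · simp only [zero_add, Nat.sub_self]; simp
      · simp
    | cons x u ih =>
      cases x
      · simp only [List.cons_append, mem_false, ih, List.count_cons_self]
        have : j - 1 = u.count false + 1 ↔ j = u.count false + 1 + 1 := by omega
        rw [this]
      · simp only [List.cons_append, mem_true, ih]
        have h1 : (u ++ false :: true :: v).count true = (u ++ true :: false :: v).count true := by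
          simp
        have h2 : (true :: u).count false = u.count false := by simp
        rw [h1, h2]
        tauto
  have hn : (v.count true + 1, u.count false + 1) ∉ shape (u ++ true :: false :: v) := by
    have h : v.count true = (false :: v).count true := by simp
    rw [h, mem_row]; omega
  ext ⟨i, j⟩
  rw [mem_erase, key]
  constructor
  · rintro ⟨h1, h2 | h2⟩
    · exact absurd (by rw [h2.1, h2.2]) h1
    · exact h2
  · intro h
    refine ⟨?_, Or.inr h⟩
    intro h'
    rw [h'] at h
    exact hn h

/-! ### The recurrences for the weight of a word -/

noncomputable def V (a b : ℚ) (w : List Bool) : ℚ := W a b (shape w)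

lemma V_nil (a b : ℚ) : V a b [] = 1 := by
  have h : TL (shape []) = {{(0, 0)}} := by
    ext P
    rw [mem_TL, mem_singleton]
    constructor
    · rintro ⟨-, h2, h3, -⟩
      ext c
      constructor
      · intro h; exact h2 h
      · intro h; rw [mem_singleton] at h; rw [h]; exact h3
    · rintro rfl
      refine ⟨young_shape _, ?_, ?_, ?_, ?_⟩
      · intro c h; exact h
      · simp
      · intro c h hne; simp only [mem_singleton] at h; exact absurd h hne
      · intro c h
        simp only [shape, mem_singleton] at h
        subst h
        exact ⟨⟨0, by simp⟩, ⟨0, by simp⟩⟩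
  unfold V W
  rw [h, sum_singleton]
  have h1 : topStat {(0, 0)} = 0 := by
    unfold topStat
    rw [card_eq_zero, filter_eq_empty_iff]
    intro c hc; rw [mem_singleton] at hc; simp [hc]
  have h2 : leftStat {(0, 0)} = 0 := by
    unfold leftStat
    rw [card_eq_zero, filter_eq_empty_iff]
    intro c hc; rw [mem_singleton] at hc; simp [hc]
  unfold wt
  rw [h1, h2]; simp

lemma V_true (a b : ℚ) (w : List Bool) : V a b (true :: w) = b * V a b w := by
  have h := row_left a b (D := shape (true :: w)) (i := w.count true + 1) (young_shape _)
    (by omega) (by rw [mem_col0]; simp)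
  have h2 := delrow_shape [] w
  simp only [List.nil_append] at h2
  rw [h2] at h
  unfold V
  rw [← h]
  unfold W
  rw [filter_true_of_mem]
  intro P hP y hy hyP
  rw [mem_TL] at hP
  have h3 := hP.2.1 hyP
  have h4 := @mem_row [] w y
  simp only [List.nil_append] at h4
  rw [h4] at h3
  simp at h3; omega

lemma V_snoc (a b : ℚ) (w : List Bool) : V a b (w ++ [false]) = a * V a b w := by
  have h := col_top a b (D := shape (w ++ [false])) (j := w.count false + 1) (young_shape _)
    (by omega) (by rw [mem_row0]; simp) (fun _ => True)
  have h2 := delcol_shape w []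
  simp only [List.append_nil] at h2
  rw [h2] at h
  unfold V W
  simp only [and_true, filter_true] at h
  rw [← h]
  rw [filter_true_of_mem]
  intro P hP x hx hxP
  rw [mem_TL] at hP
  have h3 := hP.2.1 hxP
  rw [mem_col] at h3
  simp at h3; omega

lemma V_corner (a b : ℚ) (u v : List Bool) :
    V a b (u ++ false :: true :: v) =
      V a b (u ++ true :: false :: v) + V a b (u ++ true :: v) + V a b (u ++ false :: v) := by
  have h := corner_rec a b (young_shape (u ++ false :: true :: v)) (by omega) (by omega)
    (corner_shape u v)
  rw [erase_shape, delcol_shape] at h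
  have h1 : u ++ false :: true :: v = (u ++ [false]) ++ true :: v := by simp
  have h2 : delrow (shape (u ++ false :: true :: v)) (v.count true + 1)
      = shape (u ++ false :: v) := by
    rw [h1, delrow_shape]; simp
  rw [h2] at h
  exact h

/-- Weighted number of `(a,1)` non-occupied corners at a given place. -/
lemma noc_at (a b : ℚ) (u v : List Bool) :
    ∑ P ∈ (TL (shape (u ++ false :: true :: v))).filter
      (fun P => NocA1 (shape (u ++ false :: true :: v)) P
        (v.count true + 1, u.count false + 1)), wt a b P
    = a * (V a b (u ++ true :: v) - b * V a b (u ++ v)) := by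
  set D := shape (u ++ false :: true :: v) with hD
  have hc : CornerCell D (v.count true + 1, u.count false + 1) := corner_shape u v
  have h := col_top a b (D := D) (j := u.count false + 1) (young_shape _)
    (by omega) (by rw [hD, mem_row0]; simp)
    (fun P => ∃ k, 0 < k ∧ k < u.count false + 1 ∧ (v.count true + 1, k) ∈ P)
  have e1 : (TL D).filter (fun P => NocA1 D P (v.count true + 1, u.count false + 1))
      = (TL D).filter (fun P => (∀ x, 0 < x → (x, u.count false + 1) ∉ P) ∧
        ∃ k, 0 < k ∧ k < u.count false + 1 ∧ (v.count true + 1, k) ∈ P) := by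
    ext P
    rw [mem_filter, mem_filter, mem_TL]
    constructor
    · rintro ⟨hP, -, h2, h3, h4⟩
      refine ⟨hP, fun x hx hxP => ?_, h4⟩
      have h5 := hP.2.1 hxP
      rw [hD, mem_col] at h5
      simp only [List.count_cons_self] at h5
      rcases Nat.lt_or_ge x (v.count true + 1) with hlt | hge
      · exact h3 x hx hlt hxP
      · have : x = v.count true + 1 := by omega
        rw [this] at hxP
        exact h2 hxP
    · rintro ⟨hP, h2, h3⟩
      exact ⟨hP, hc, h2 _ (by omega), fun r hr _ => h2 r hr, h3⟩
  rw [e1, h, hD, delcol_shape]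
  congr 1
  have h5 := row_left a b (D := shape (u ++ true :: v)) (i := v.count true + 1) (young_shape _)
    (by omega) (by rw [mem_row]; omega)
  rw [delrow_shape] at h5
  unfold V
  rw [← h5]
  unfold W
  rw [eq_sub_iff_add_eq, ← Finset.sum_filter_add_sum_filter_not (TL (shape (u ++ true :: v)))
    (fun P => (∀ y, 0 < y → (v.count true + 1, y) ∉ P)), add_comm]
  congr 1
  refine Finset.sum_congr ?_ fun _ _ => rfl
  ext P
  rw [mem_filter, mem_filter, mem_TL]
  refine and_congr_right fun hP => ?_
  push Not
  constructor
  · rintro ⟨k, h1, h2, h3⟩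
    rw [← sg_of_lt h2, mem_ins_sg] at h3
    exact ⟨k, h1, h3⟩
  · rintro ⟨k, h1, h3⟩
    have h4 := hP.2.1 h3
    rw [mem_row] at h4
    have h2 : k < u.count false + 1 := by omega
    refine ⟨k, h1, h2, ?_⟩
    rw [← sg_of_lt h2, mem_ins_sg]
    exact h3

/-! ### Sums over words -/

def S : ℕ → (List Bool → ℚ) → ℚ
  | 0, f => f []
  | n + 1, f => S n (fun w => f (false :: w)) + S n (fun w => f (true :: w))

lemma S_add (n : ℕ) (f g : List Bool → ℚ) : S n (fun w => f w + g w) = S n f + S n g := by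
  induction n generalizing f g with
  | zero => rfl
  | succ n ih => simp only [S, ih]; ring

lemma S_mul (n : ℕ) (c : ℚ) (f : List Bool → ℚ) : S n (fun w => c * f w) = c * S n f := by
  induction n generalizing f with
  | zero => rfl
  | succ n ih => simp only [S, ih]; ring

lemma S_sub (n : ℕ) (f g : List Bool → ℚ) : S n (fun w => f w - g w) = S n f - S n g := by
  induction n generalizing f g with
  | zero => rfl
  | succ n ih => simp only [S, ih]; ring

lemma S_zero (n : ℕ) : S n (fun _ => 0) = 0 := by
  have := S_mul n 0 (fun _ => 0)
  simpa using this

lemma S_congr {n : ℕ} {f g : List Bool → ℚ} (h : ∀ w, f w = g w) : S n f = S n g := by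
  have : f = g := funext h
  rw [this]

lemma S_snoc (n : ℕ) (f : List Bool → ℚ) :
    S (n + 1) f = S n (fun w => f (w ++ [false])) + S n (fun w => f (w ++ [true])) := by
  induction n generalizing f with
  | zero => rfl
  | succ n ih =>
    rw [S, ih, ih]
    simp only [S, List.cons_append]
    ring

lemma S_append (m n : ℕ) (f : List Bool → ℚ) :
    S m (fun u => S n (fun v => f (u ++ v))) = S (m + n) f := by
  induction m generalizing f with
  | zero => simp [S]
  | succ m ih =>
    rw [Nat.succ_add]
    simp only [S]
    rw [← ih, ← ih]
    rfl

lemma S_row (a b : ℚ) (k : ℕ) (v : List Bool) :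
    S k (fun u => V a b (u ++ true :: v)) = (b + k) * S k (fun u => V a b (u ++ v)) := by
  induction k generalizing v with
  | zero => simp [S, V_true]
  | succ k ih =>
    rw [S_snoc, S_snoc]
    simp only [List.append_assoc, List.singleton_append, List.cons_append, List.nil_append]
    simp only [V_corner, S_add]
    rw [ih, ih, ih]
    have h := ih v
    push_cast
    rw [h]
    ring

lemma S_V (a b : ℚ) (N : ℕ) : S N (V a b) = ∏ k ∈ Finset.range N, (a + b + k) := by
  induction N with
  | zero => simp [S, V_nil]
  | succ N ih =>
    rw [S_snoc, prod_range_succ, ← ih]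
    simp only [V_snoc, S_mul]
    rw [S_row]
    simp only [List.append_nil]
    ring

/-! ### Interior corners -/

noncomputable def IC (D : Finset (ℕ × ℕ)) : Finset (ℕ × ℕ) :=
  D.filter (fun c => CornerCell D c ∧ 1 ≤ c.1 ∧ 1 ≤ c.2)

lemma mem_IC {D : Finset (ℕ × ℕ)} {i j : ℕ} : (i, j) ∈ IC D ↔
    ((i, j) ∈ D ∧ (i + 1, j) ∉ D ∧ (i, j + 1) ∉ D) ∧ 1 ≤ i ∧ 1 ≤ j := by
  unfold IC
  rw [mem_filter]
  exact ⟨fun h => h.2, fun h => ⟨h.1.1, h⟩⟩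

def bonus : List Bool → Finset (ℕ × ℕ)
  | true :: w => {(w.count true + 1, 1)}
  | _ => ∅

lemma IC_true (w : List Bool) : IC (shape (true :: w)) = IC (shape w) := by
  ext ⟨i, j⟩
  simp only [mem_IC, mem_true]
  constructor
  · rintro ⟨⟨h1, h2, h3⟩, h4, h5⟩
    refine ⟨⟨?_, fun h => h2 (Or.inr h), fun h => h3 (Or.inr h)⟩, h4, h5⟩
    rcases h1 with h1 | h1
    · omega
    · exact h1
  · rintro ⟨⟨h1, h2, h3⟩, h4, h5⟩
    refine ⟨⟨Or.inr h1, ?_, ?_⟩, h4, h5⟩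
    · rintro (h | h)
      · omega
      · exact h2 h
    · rintro (h | h)
      · omega
      · exact h3 h

lemma mem_bonus (w : List Bool) (i j : ℕ) : (i, j) ∈ bonus w ↔
    ((i, 0) ∈ shape w ∧ (i + 1, 0) ∉ shape w ∧ (i, 1) ∉ shape w) ∧ 1 ≤ i ∧ j = 1 := by
  rcases w with _ | ⟨x, w⟩
  · simp only [bonus, notMem_empty, mem_nil, false_iff]
    omega
  · cases x
    · simp only [bonus, notMem_empty, mem_false, false_iff]
      rintro ⟨⟨h1, -, h3⟩, -⟩
      exact h3 h1
    · simp only [bonus, mem_singleton, mem_col0, Prod.mk.injEq, List.count_cons_self, mem_true]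
      constructor
      · rintro ⟨rfl, rfl⟩
        refine ⟨⟨le_rfl, by omega, ?_⟩, by omega, rfl⟩
        rintro (h | h)
        · omega
        · have := row_le h; omega
      · rintro ⟨⟨h1, h2, -⟩, -, h3⟩
        omega

lemma IC_false_sum (w : List Bool) (h : ℕ × ℕ → ℚ) :
    ∑ c ∈ IC (shape (false :: w)), h c
      = ∑ c ∈ bonus w, h c + ∑ c ∈ IC (shape w), h (c.1, c.2 + 1) := by
  have e : IC (shape (false :: w)) = bonus w ∪ (IC (shape w)).image (fun c => (c.1, c.2 + 1)) := by
    ext ⟨i, j⟩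
    rw [mem_union, mem_bonus, mem_IC, mem_image]
    simp only [mem_false]
    constructor
    · rintro ⟨⟨h1, h2, h3⟩, h4, h5⟩
      obtain ⟨j, rfl⟩ : ∃ j', j = j' + 1 := ⟨j - 1, by omega⟩
      simp only [Nat.add_sub_cancel] at h1 h2 h3
      rcases Nat.eq_zero_or_pos j with rfl | hj
      · left; exact ⟨⟨h1, h2, h3⟩, h4, rfl⟩
      · right; exact ⟨(i, j), mem_IC.2 ⟨⟨h1, h2, h3⟩, h4, hj⟩, rfl⟩
    · rintro (⟨⟨h1, h2, h3⟩, h4, rfl⟩ | ⟨⟨x, y⟩, h1, h2⟩)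
      · exact ⟨⟨h1, h2, h3⟩, h4, le_rfl⟩
      · rw [mem_IC] at h1
        obtain ⟨rfl, rfl⟩ := Prod.mk.inj h2
        exact ⟨h1.1, h1.2.1, by simp⟩
  rw [e, sum_union, sum_image]
  · rintro ⟨x, y⟩ _ ⟨x', y'⟩ _ hh
    simp only [Prod.mk.injEq] at hh ⊢
    omega
  · rw [disjoint_left]
    rintro ⟨i, j⟩ h1 h2
    rw [mem_bonus] at h1
    rw [mem_image] at h2
    obtain ⟨⟨x, y⟩, h3, h4⟩ := h2
    rw [mem_IC] at h3
    simp only [Prod.mk.injEq] at h4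
    omega

lemma corner_sum (N : ℕ) (g : List Bool → ℕ × ℕ → ℚ) :
    S (N + 1) (fun w => ∑ c ∈ IC (shape w), g w c)
      = ∑ k ∈ range N, S k (fun u => S (N - 1 - k) (fun v =>
          g (u ++ false :: true :: v) (v.count true + 1, u.count false + 1))) := by
  induction N generalizing g with
  | zero =>
    have h0 : IC (shape []) = ∅ := by
      ext ⟨i, j⟩
      rw [mem_IC, mem_nil]
      simp only [notMem_empty, iff_false]
      omega
    simp [S, IC_true, IC_false_sum, h0, bonus]
  | succ N ih =>
    rw [S]
    simp only [IC_true, IC_false_sum]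
    rw [S_add, ih (fun w c => g (false :: w) (c.1, c.2 + 1)), ih (fun w c => g (true :: w) c),
      sum_range_succ']
    have hb : S (N + 1) (fun w => ∑ c ∈ bonus w, g (false :: w) c)
        = S N (fun v => g (false :: true :: v) (v.count true + 1, 1)) := by
      simp only [S, bonus, sum_empty, sum_singleton, S_zero, zero_add]
    rw [hb]
    have h2 : ∀ k, N + 1 - 1 - (k + 1) = N - 1 - k := by intro k; omega
    simp only [h2]
    simp only [S, sum_add_distrib, List.cons_append, List.nil_append, List.count_cons_self,
      List.count_nil, Nat.add_sub_cancel, Nat.sub_zero, zero_add]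
    have h3 : ∀ u : List Bool, (true :: u).count false = u.count false := by intro u; simp
    simp only [h3]
    ring

/-! ### Tableaux and words -/

lemma shape_inj {w w' : List Bool} (h : shape w = shape w') : w = w' := by
  induction w generalizing w' with
  | nil =>
    rcases w' with _ | ⟨x, w'⟩
    · rfl
    · exfalso
      cases x
      · have : (0, 1) ∈ shape [] := by rw [h, mem_row0]; simp
        rw [mem_nil] at this; omega
      · have : (1, 0) ∈ shape [] := by rw [h, mem_col0]; simp
        rw [mem_nil] at this; omega
  | cons x w ih =>
    have hne : ∀ w w' : List Bool, shape (false :: w) ≠ shape (true :: w') := by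
      intro w w' h
      have h1 : (w'.count true + 1, 0) ∈ shape (false :: w) := by
        rw [h, mem_col0]; simp
      have h2 : (w'.count true + 1, 1) ∈ shape (false :: w) := by
        rw [mem_false] at h1 ⊢; exact h1
      rw [h, mem_true] at h2
      rcases h2 with h2 | h2
      · omega
      · have := row_le h2; omega
    rcases w' with _ | ⟨x', w'⟩
    · exfalso
      cases x
      · have : (0, 1) ∈ shape [] := by rw [← h, mem_row0]; simp
        rw [mem_nil] at this; omega
      · have : (1, 0) ∈ shape [] := by rw [← h, mem_col0]; simp
        rw [mem_nil] at this; omega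
    · cases x <;> cases x'
      · congr 1
        apply ih
        ext ⟨i, j⟩
        have h1 : (i, j + 1) ∈ shape (false :: w) ↔ (i, j) ∈ shape w := by rw [mem_false]; simp
        have h2 : (i, j + 1) ∈ shape (false :: w') ↔ (i, j) ∈ shape w' := by rw [mem_false]; simp
        rw [← h1, ← h2, h]
      · exact absurd h (hne _ _)
      · exact absurd h.symm (hne _ _)
      · congr 1
        apply ih
        have hc : w.count true = w'.count true := by
          have h1 : ((true :: w).count true, 0) ∈ shape (true :: w) := mem_col0.2 le_rfl
          have h2 : ((true :: w').count true, 0) ∈ shape (true :: w') := mem_col0.2 le_rfl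
          rw [h, mem_col0] at h1
          rw [← h, mem_col0] at h2
          simp only [List.count_cons_self] at h1 h2
          omega
        have e : ∀ w : List Bool, shape w = (shape (true :: w)).erase (w.count true + 1, 0) := by
          intro w
          rw [shape, erase_insert]
          rw [mem_col0]; omega
        rw [e w, e w', h, hc]

lemma shape_surj (D : Finset (ℕ × ℕ)) (hD : IsYoung D) (h0 : (0, 0) ∈ D) :
    ∃ w, shape w = D := by
  induction hn : D.card using Nat.strong_induction_on generalizing D with
  | _ n ih =>
    subst hn
    have hne : (D.filter (fun c => c.2 = 0)).Nonempty := ⟨(0, 0), by simp [h0]⟩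
    obtain ⟨⟨i, z⟩, hi, hmax⟩ := exists_max_image _ (fun c : ℕ × ℕ => c.1) hne
    rw [mem_filter] at hi
    obtain ⟨hi, hz⟩ := hi
    simp only at hz
    subst hz
    have hm : ∀ x y, (x, y) ∈ D → x ≤ i := by
      intro x y h
      exact hmax (x, 0) (mem_filter.2 ⟨hD _ _ _ _ h le_rfl (Nat.zero_le _), rfl⟩)
    by_cases h1 : (i, 1) ∈ D
    · obtain ⟨w, hw⟩ := ih (delcol D 0).card (by
          have : (delcol D 0).card = ((delcol D 0).image (sgc 0)).card :=
            (card_image_of_injective _ (sgc_inj 0)).symm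
          rw [this]
          apply card_lt_card
          rw [ssubset_iff_of_subset]
          · refine ⟨(0, 0), h0, ?_⟩
            rw [mem_image]
            rintro ⟨c, _, h⟩
            exact sg_ne _ _ (Prod.mk.inj h).2
          · intro c hc
            rw [mem_image] at hc
            obtain ⟨⟨x, y⟩, h, rfl⟩ := hc
            exact mem_delcol.1 h) (delcol D 0) (young_delcol hD 0)
          (by rw [mem_delcol]; exact hD _ _ _ _ h1 (Nat.zero_le _) (by simp [sg])) rfl
      refine ⟨false :: w, ?_⟩
      ext ⟨x, y⟩
      rw [mem_false, hw, mem_delcol]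
      have hs : ∀ y, sg 0 y = y + 1 := by intro y; simp [sg]
      rw [hs]
      rcases y with _ | y
      · constructor
        · intro h; exact hD _ _ _ _ h le_rfl (by omega)
        · intro h; exact hD _ _ _ _ h1 (hm _ _ h) (by omega)
      · simp
    · have hcol : ∀ y, (i, y) ∈ D → y = 0 := by
        intro y h
        by_contra hy
        exact h1 (hD _ _ _ _ h le_rfl (by omega))
      rcases Nat.eq_zero_or_pos i with rfl | hpos
      · refine ⟨[], ?_⟩
        ext ⟨x, y⟩
        rw [mem_nil]
        constructor
        · rintro ⟨rfl, rfl⟩; exact h0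
        · intro h
          have hx := hm _ _ h
          have : x = 0 := by omega
          subst this
          exact ⟨rfl, hcol _ h⟩
      · have hcorner : CornerCell D (i, 0) :=
          ⟨hi, fun h => by have := hm _ _ h; simp only at this; omega, h1⟩
        obtain ⟨w, hw⟩ := ih (D.erase (i, 0)).card (card_erase_lt_of_mem hi) (D.erase (i, 0))
          (young_erase hD hcorner)
          (by rw [mem_erase]; exact ⟨by rw [ne_eq, Prod.mk.injEq]; omega, h0⟩) rfl
        refine ⟨true :: w, ?_⟩
        have hc : w.count true + 1 = i := by
          have h2 : ∀ x, x ≤ w.count true ↔ (x ≠ i ∧ (x, 0) ∈ D) := by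
            intro x
            rw [← mem_col0, hw, mem_erase]
            simp
          have h3 := (h2 (w.count true)).1 le_rfl
          have h4 := hm _ _ h3.2
          have h5 := (h2 (i - 1)).2 ⟨by omega, hD _ _ _ _ hi (by omega) le_rfl⟩
          omega
        rw [shape, hw, hc, insert_erase hi]

lemma card_tops {D P : Finset (ℕ × ℕ)} (h : IsTLT D P) {m : ℕ}
    (hm : ∀ j, (0, j) ∈ D ↔ j < m) :
    (P.filter (fun c => ¬ ∃ r < c.1, (r, c.2) ∈ P)).card = m := by
  obtain ⟨h1, h2, h3, h4, h5⟩ := h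
  have e : (P.filter (fun c => ¬ ∃ r < c.1, (r, c.2) ∈ P)).image Prod.snd = range m := by
    ext j
    rw [mem_image, mem_range, ← hm]
    constructor
    · rintro ⟨⟨x, y⟩, h, rfl⟩
      rw [mem_filter] at h
      exact h1 _ _ _ _ (h2 h.1) (Nat.zero_le _) le_rfl
    · intro h
      have hex := (h5 _ h).2
      simp only at hex
      refine ⟨(Nat.find hex, j), mem_filter.2 ⟨Nat.find_spec hex, ?_⟩, rfl⟩
      rintro ⟨r, hr, hrP⟩
      exact Nat.find_min hex hr hrP
  rw [← card_range m, ← e, card_image_of_injOn]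
  rintro ⟨x, y⟩ hc ⟨x', y'⟩ hc' heq
  simp only at heq
  subst heq
  rw [mem_coe, mem_filter] at hc hc'
  rcases lt_trichotomy x x' with hlt | rfl | hlt
  · exact absurd ⟨x, hlt, hc.1⟩ hc'.2
  · rfl
  · exact absurd ⟨x', hlt, hc'.1⟩ hc.2

lemma card_TL {w : List Bool} {P : Finset (ℕ × ℕ)} (h : IsTLT (shape w) P) :
    P.card = w.length + 1 := by
  have hA := card_tops h (m := w.count false + 1) (fun j => by rw [mem_row0]; omega)
  have hB := card_tops (isTLT_sw h) (m := w.count true + 1)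
    (fun j => by rw [mem_sw, mem_col0]; omega)
  have hB' : (P.filter (fun c => ¬ ∃ k < c.2, (c.1, k) ∈ P)).card = w.count true + 1 := by
    rw [← hB, ← card_sw]
    congr 1
    ext ⟨x, y⟩
    simp only [mem_sw, mem_filter]
  have hI : P.filter (fun c => ¬ ∃ r < c.1, (r, c.2) ∈ P) ∩
      P.filter (fun c => ¬ ∃ k < c.2, (c.1, k) ∈ P) = {(0, 0)} := by
    ext c
    rw [mem_inter, mem_filter, mem_filter, mem_singleton]
    constructor
    · rintro ⟨⟨hc, h1⟩, -, h2⟩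
      by_contra hne
      exact h1 ((h.2.2.2.1 c hc hne).2 h2)
    · rintro rfl
      exact ⟨⟨h.2.2.1, by simp⟩, h.2.2.1, by simp⟩
  have hU : P.filter (fun c => ¬ ∃ r < c.1, (r, c.2) ∈ P) ∪
      P.filter (fun c => ¬ ∃ k < c.2, (c.1, k) ∈ P) = P := by
    ext c
    rw [mem_union, mem_filter, mem_filter]
    constructor
    · rintro (h | h) <;> exact h.1
    · intro hc
      by_cases hu : ∃ r < c.1, (r, c.2) ∈ P
      · by_cases hne : c = (0, 0)
        · subst hne; simp at hu
        · exact Or.inr ⟨hc, (h.2.2.2.1 c hc hne).1 hu⟩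
      · exact Or.inl ⟨hc, hu⟩
  have := card_union_add_card_inter (P.filter (fun c => ¬ ∃ r < c.1, (r, c.2) ∈ P))
    (P.filter (fun c => ¬ ∃ k < c.2, (c.1, k) ∈ P))
  rw [hI, hU, hA, hB', card_singleton] at this
  have hl := List.count_true_add_count_false w
  omega

def wordsF : ℕ → Finset (List Bool)
  | 0 => {[]}
  | n + 1 => (wordsF n).image (List.cons false) ∪ (wordsF n).image (List.cons true)

lemma mem_wordsF {n : ℕ} {w : List Bool} : w ∈ wordsF n ↔ w.length = n := by
  induction n generalizing w with
  | zero => simp [wordsF]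
  | succ n ih =>
    rw [wordsF, mem_union, mem_image, mem_image]
    rcases w with _ | ⟨x, w⟩
    · simp
    · cases x <;> simp [ih]

lemma sum_wordsF (n : ℕ) (f : List Bool → ℚ) : ∑ w ∈ wordsF n, f w = S n f := by
  induction n generalizing f with
  | zero => simp [wordsF, S]
  | succ n ih =>
    rw [wordsF, sum_union, sum_image (by intro x _ y _ h; exact (List.cons.inj h).2),
      sum_image (by intro x _ y _ h; exact (List.cons.inj h).2), ih, ih, S]
    rw [disjoint_left]
    intro w h1 h2
    rw [mem_image] at h1 h2
    obtain ⟨x, _, rfl⟩ := h1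
    obtain ⟨y, _, h⟩ := h2
    simp at h

lemma TLTs_sum (N : ℕ) (f : Finset (ℕ × ℕ) × Finset (ℕ × ℕ) → ℚ) :
    ∑ T ∈ TLTs (N + 1), f T = S N (fun w => ∑ P ∈ TL (shape w), f (shape w, P)) := by
  have e : TLTs (N + 1) = (wordsF N).biUnion (fun w => (TL (shape w)).image (fun P => (shape w, P))) := by
    ext ⟨D, P⟩
    simp only [TLTs, mem_filter, mem_product, mem_powerset, mem_biUnion, mem_image, mem_wordsF,
      mem_TL, Prod.mk.injEq]
    constructor
    · rintro ⟨-, h, hc⟩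
      obtain ⟨w, rfl⟩ := shape_surj D h.1 (h.2.1 h.2.2.1)
      have := card_TL h
      exact ⟨w, by omega, P, h, rfl, rfl⟩
    · rintro ⟨w, hw, P', h, rfl, rfl⟩
      have hs : shape w ⊆ range (N + 1 + 1) ×ˢ range (N + 1 + 1) := by
        rintro ⟨i, j⟩ hij
        rw [mem_product, mem_range, mem_range]
        have h1 := row_le hij
        have h2 := col_le hij
        have h3 := List.count_le_length (a := true) (l := w)
        have h4 := List.count_le_length (a := false) (l := w)
        simp only
        omega
      exact ⟨⟨hs, h.2.1.trans hs⟩, h, by rw [card_TL h, hw]⟩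
  rw [e, sum_biUnion, ← sum_wordsF]
  · refine sum_congr rfl fun w _ => ?_
    rw [sum_image]
    intro x _ y _ h
    exact (Prod.mk.inj h).2
  · intro w _ w' _ hne
    simp only [Function.onFun]
    rw [disjoint_left]
    intro c h1 h2
    rw [mem_image] at h1 h2
    obtain ⟨x, _, rfl⟩ := h1
    obtain ⟨y, _, h⟩ := h2
    exact hne (shape_inj (Prod.mk.inj h).1.symm)

/-! ### Conclusion -/

lemma main_A (n : ℕ) (hn : 3 ≤ n) (a b : ℚ) :
    ∑ T ∈ TLTs n,
        ((T.1.filter (NocA1 T.1 T.2)).card : ℚ) * a ^ topStat T.2 * b ^ leftStat T.2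
      = ((n - 2).choose 2 : ℚ) * a * ∏ k ∈ Finset.range (n - 3), (a + b + k) := by
  obtain ⟨M, rfl⟩ : ∃ M, n = M + 1 + 1 + 1 := ⟨n - 3, by omega⟩
  rw [TLTs_sum]
  have e1 : ∀ w : List Bool, ∑ P ∈ TL (shape w),
      (((shape w).filter (NocA1 (shape w) P)).card : ℚ) * a ^ topStat P * b ^ leftStat P
      = ∑ c ∈ IC (shape w), ∑ P ∈ (TL (shape w)).filter (fun P => NocA1 (shape w) P c),
          wt a b P := by
    intro w
    have e2 : ∀ P ∈ TL (shape w), (((shape w).filter (NocA1 (shape w) P)).card : ℚ)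
        * a ^ topStat P * b ^ leftStat P
        = ∑ c ∈ IC (shape w), if NocA1 (shape w) P c then wt a b P else 0 := by
      intro P hP
      rw [mem_TL] at hP
      have e3 : (shape w).filter (NocA1 (shape w) P) = (IC (shape w)).filter (NocA1 (shape w) P) := by
        ext ⟨i, j⟩
        rw [mem_filter, mem_filter]
        constructor
        · rintro ⟨h1, h2⟩
          refine ⟨mem_IC.2 ⟨h2.1, ?_, ?_⟩, h2⟩
          · by_contra hlt
            have hi : i = 0 := by omega
            subst hi
            obtain ⟨-, ⟨r, hr⟩⟩ := hP.2.2.2.2 _ h1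
            simp only at hr
            have h3 := hP.2.1 hr
            rcases Nat.eq_zero_or_pos r with rfl | hp
            · exact h2.2.1 hr
            · exact h2.1.2.1 (young_shape w _ _ _ _ h3 hp le_rfl)
          · obtain ⟨k, hk, hk', -⟩ := h2.2.2.2
            simp only at hk'
            omega
        · rintro ⟨h1, h2⟩
          exact ⟨h2.1.1, h2⟩
      rw [e3, ← Finset.sum_filter, sum_const, nsmul_eq_mul, wt]
      ring
    rw [sum_congr rfl e2, sum_comm]
    refine sum_congr rfl fun c _ => ?_
    rw [Finset.sum_filter]
  simp only [e1]
  rw [corner_sum (M + 1) (fun w c =>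
    ∑ P ∈ (TL (shape w)).filter (fun P => NocA1 (shape w) P c), wt a b P)]
  simp only [noc_at, S_mul, S_sub]
  have e4 : ∀ k ∈ range (M + 1), a * (S k (fun u => S (M + 1 - 1 - k) fun v => V a b (u ++ true :: v))
      - b * S k (fun u => S (M + 1 - 1 - k) fun v => V a b (u ++ v)))
      = a * (k : ℚ) * S M (V a b) := by
    intro k hk
    rw [mem_range] at hk
    have hS : ∀ (m n : ℕ) (f : List Bool → List Bool → ℚ),
        S m (fun u => S n (fun v => f u v)) = S n (fun v => S m (fun u => f u v)) := by
      intro m n f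
      simp only [← sum_wordsF]
      exact sum_comm
    rw [hS]
    simp only [S_row, S_mul]
    rw [hS, S_append]
    have : k + (M + 1 - 1 - k) = M := by omega
    rw [this]
    ring
  rw [sum_congr rfl e4, ← sum_mul, ← mul_sum, S_V]
  have e5 : (∑ k ∈ range (M + 1), (k : ℚ)) = ((M + 1).choose 2 : ℚ) := by
    rw [← Nat.cast_sum]
    congr 1
    rw [Finset.sum_range_id, Nat.choose_two_right]
  rw [e5]
  have e6 : M + 1 + 1 + 1 - 2 = M + 1 := by omega
  have e7 : M + 1 + 1 + 1 - 3 = M := by omega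
  rw [e6, e7]
  ring

lemma nocB_sw {D P : Finset (ℕ × ℕ)} :
    ((sw D).filter (NocA1 (sw D) (sw P))).card = (D.filter (Noc1B D P)).card := by
  rw [← card_sw (D.filter _)]
  congr 1
  ext ⟨x, y⟩
  simp only [mem_filter, mem_sw, NocA1, Noc1B, CornerCell]
  tauto

lemma main_B (n : ℕ) (hn : 3 ≤ n) (a b : ℚ) :
    ∑ T ∈ TLTs n,
        ((T.1.filter (Noc1B T.1 T.2)).card : ℚ) * a ^ topStat T.2 * b ^ leftStat T.2
      = ((n - 2).choose 2 : ℚ) * b * ∏ k ∈ Finset.range (n - 3), (a + b + k) := by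
  have h := main_A n hn b a
  rw [add_comm b a] at h
  rw [← h]
  have hsub : ∀ D : Finset (ℕ × ℕ), D ⊆ range (n + 1) ×ˢ range (n + 1) →
      sw D ⊆ range (n + 1) ×ˢ range (n + 1) := by
    rintro D hD ⟨x, y⟩ hc
    rw [mem_sw] at hc
    have := hD hc
    rw [mem_product] at this ⊢
    exact ⟨this.2, this.1⟩
  have hmem : ∀ T ∈ TLTs n, (sw T.1, sw T.2) ∈ TLTs n := by
    intro T hT
    simp only [TLTs, mem_filter, mem_product, mem_powerset] at hT ⊢
    exact ⟨⟨hsub _ hT.1.1, hsub _ hT.1.2⟩, isTLT_sw hT.2.1, by rw [card_sw]; exact hT.2.2⟩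
  refine Finset.sum_bij' (fun T _ => (sw T.1, sw T.2)) (fun T _ => (sw T.1, sw T.2))
    hmem hmem ?_ ?_ ?_
  · intro T _; simp only [sw_sw]
  · intro T _; simp only [sw_sw]
  · intro T _
    simp only
    rw [nocB_sw, top_sw, left_sw]
    ring

end Aux

open scoped Classical in
theorem stmt16 (n : ℕ) (hn : 3 ≤ n) (a b : ℚ) :
    (∑ T ∈ TLTs n,
        ((T.1.filter (NocA1 T.1 T.2)).card : ℚ) * a ^ topStat T.2 * b ^ leftStat T.2
      = ((n - 2).choose 2 : ℚ) * a * ∏ k ∈ Finset.range (n - 3), (a + b + k)) ∧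
    (∑ T ∈ TLTs n,
        ((T.1.filter (Noc1B T.1 T.2)).card : ℚ) * a ^ topStat T.2 * b ^ leftStat T.2
      = ((n - 2).choose 2 : ℚ) * b * ∏ k ∈ Finset.range (n - 3), (a + b + k)) := by
  exact ⟨main_A n hn a b, main_B n hn a b⟩
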